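/- Let p ∈ C²_poly(ℝⁿ) be a probability density with respect to γ (p ≥ 0 and ∫ p dγ = 1). Then the χ²-divergence of P = p·γ from γ satisfies ∫ (p(x) − 1)² dγ(x) ≤ ∫ (δ·∇ p(x))² dγ(x). -/

import Mathlib

open MeasureTheory Real
open scoped RealInnerProductSpace BigOperators

noncomputable section

/-- The standard Gaussian measure on `ℝⁿ`, with density
`(2π)^(-n/2) exp(-|x|²/2)` with respect to Lebesgue measure. -/
def gaussianMeasure (n : ℕ) : Measure (EuclideanSpace ℝ (Fin n)) :=
  volume.withDensity fun x => ENNReal.ofReal ((2 * π) ^ (-(n : ℝ) / 2) * Real.exp (-‖x‖ ^ 2 / 2))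

/-- `C^k_poly(ℝⁿ)`: `C^k` functions which, together with all derivatives up to
order `k`, are bounded by a polynomial. -/
def CPoly (k n : ℕ) (f : EuclideanSpace ℝ (Fin n) → ℝ) : Prop :=
  ContDiff ℝ k f ∧
    ∀ i, i ≤ k → ∃ (C : ℝ) (m : ℕ), ∀ x, ‖iteratedFDeriv ℝ i f x‖ ≤ C * (1 + ‖x‖) ^ m

/-- The `i`-th partial derivative. -/
def partialDeriv {n : ℕ} (i : Fin n) (f : EuclideanSpace ℝ (Fin n) → ℝ)
    (x : EuclideanSpace ℝ (Fin n)) : ℝ :=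
  fderiv ℝ f x (EuclideanSpace.single i 1)

/-- The Laplacian. -/
def laplacian {n : ℕ} (f : EuclideanSpace ℝ (Fin n) → ℝ) (x : EuclideanSpace ℝ (Fin n)) : ℝ :=
  ∑ i : Fin n, partialDeriv i (partialDeriv i f) x

/-- The Ornstein–Uhlenbeck operator `δ·∇ f (x) = x·∇f(x) − Δf(x)`. -/
def ouOperator {n : ℕ} (f : EuclideanSpace ℝ (Fin n) → ℝ) (x : EuclideanSpace ℝ (Fin n)) : ℝ :=
  ⟪x, gradient f x⟫ - laplacian f x

/-- The Ornstein–Uhlenbeck semigroup given by the Mehler formula. -/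
def ouSemigroup (n : ℕ) (t : ℝ) (f : EuclideanSpace ℝ (Fin n) → ℝ)
    (x : EuclideanSpace ℝ (Fin n)) : ℝ :=
  ∫ y, f (Real.exp (-t) • x + Real.sqrt (1 - Real.exp (-2 * t)) • y) ∂gaussianMeasure n

/-- A Young function: the primitive of a continuous, strictly increasing function
`φ` with `φ(0) = 0` and `φ(u) → ∞`. -/
def IsYoung (Φ : ℝ → ℝ) : Prop :=
  ∃ φ : ℝ → ℝ, ContinuousOn φ (Set.Ici 0) ∧ StrictMonoOn φ (Set.Ici 0) ∧ φ 0 = 0 ∧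
    Filter.Tendsto φ Filter.atTop Filter.atTop ∧
    ∀ x, 0 ≤ x → Φ x = ∫ u in (0:ℝ)..x, φ u

/-- The Luxemburg norm of `f` in the Orlicz space `L_Φ(γ)` over the Gaussian space. -/
def luxNorm (n : ℕ) (Φ : ℝ → ℝ) (f : EuclideanSpace ℝ (Fin n) → ℝ) : ℝ :=
  sInf {α : ℝ | 0 < α ∧ ∫ x, Φ (|f x| / α) ∂gaussianMeasure n ≤ 1}

end

open ProbabilityTheory

/-- Continuous maps of at most polynomial growth. -/
def PolyGrowth {V W : Type*} [NormedAddCommGroup V] [NormedAddCommGroup W] (f : V → W) : Prop :=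
  Continuous f ∧ ∃ (C : ℝ) (m : ℕ), 0 ≤ C ∧ ∀ x, ‖f x‖ ≤ C * (1 + ‖x‖) ^ m

namespace PolyGrowth

variable {V W U : Type*} [NormedAddCommGroup V] [NormedAddCommGroup W] [NormedAddCommGroup U]

lemma of_bound {f : V → W} (hf : Continuous f) {C : ℝ} {m : ℕ}
    (h : ∀ x, ‖f x‖ ≤ C * (1 + ‖x‖) ^ m) : PolyGrowth f := by
  refine ⟨hf, C, m, ?_, h⟩
  simpa using (norm_nonneg _).trans (h 0)

lemma const (c : W) : PolyGrowth (fun _ : V => c) :=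
  of_bound continuous_const (C := ‖c‖) (m := 0) (by simp)

lemma clm [NormedSpace ℝ V] [NormedSpace ℝ W] (L : V →L[ℝ] W) : PolyGrowth (fun x => L x) := by
  refine of_bound L.continuous (C := ‖L‖) (m := 1) fun x => (L.le_opNorm x).trans ?_
  gcongr
  simp

lemma bound_mono {C r : ℝ} (hC : 0 ≤ C) (hr : 0 ≤ r) {m k : ℕ} (hmk : m ≤ k) :
    C * (1 + r) ^ m ≤ C * (1 + r) ^ k := by
  gcongr
  linarith

lemma add {f g : V → W} (hf : PolyGrowth f) (hg : PolyGrowth g) :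
    PolyGrowth (fun x => f x + g x) := by
  obtain ⟨hfc, C, m, hC, hf⟩ := hf
  obtain ⟨hgc, D, k, hD, hg⟩ := hg
  refine of_bound (hfc.add hgc) (C := C + D) (m := m + k) fun x => ?_
  calc ‖f x + g x‖ ≤ ‖f x‖ + ‖g x‖ := norm_add_le _ _
    _ ≤ C * (1 + ‖x‖) ^ (m + k) + D * (1 + ‖x‖) ^ (m + k) :=
      add_le_add ((hf x).trans (bound_mono hC (norm_nonneg x) (by lia)))
        ((hg x).trans (bound_mono hD (norm_nonneg x) (by lia)))
    _ = _ := by ring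

lemma bilin [NormedSpace ℝ V] [NormedSpace ℝ W] [NormedSpace ℝ U] {X : Type*}
    [NormedAddCommGroup X] [NormedSpace ℝ X] (B : W →L[ℝ] U →L[ℝ] X) {f : V → W} {g : V → U}
    (hf : PolyGrowth f) (hg : PolyGrowth g) : PolyGrowth (fun x => B (f x) (g x)) := by
  obtain ⟨hfc, C, m, hC, hf⟩ := hf
  obtain ⟨hgc, D, k, hD, hg⟩ := hg
  refine of_bound (by fun_prop) (C := ‖B‖ * C * D) (m := m + k) fun x => ?_
  calc ‖B (f x) (g x)‖ ≤ ‖B‖ * ‖f x‖ * ‖g x‖ := B.le_opNorm₂ _ _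
    _ ≤ ‖B‖ * (C * (1 + ‖x‖) ^ m) * (D * (1 + ‖x‖) ^ k) := by
      gcongr
      exacts [hf x, hg x]
    _ = _ := by ring

lemma mul [NormedSpace ℝ V] {f g : V → ℝ} (hf : PolyGrowth f) (hg : PolyGrowth g) :
    PolyGrowth (fun x => f x * g x) :=
  bilin (ContinuousLinearMap.mul ℝ ℝ) hf hg

lemma sub [NormedSpace ℝ V] {f g : V → ℝ} (hf : PolyGrowth f) (hg : PolyGrowth g) :
    PolyGrowth (fun x => f x - g x) := by
  simpa [sub_eq_add_neg] using hf.add ((const (-1 : ℝ)).mul hg)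

lemma sq [NormedSpace ℝ V] {f : V → ℝ} (hf : PolyGrowth f) : PolyGrowth (fun x => f x ^ 2) := by
  simpa only [pow_two] using hf.mul hf

lemma sum [NormedSpace ℝ V] {ι : Type*} (s : Finset ι) {f : ι → V → ℝ}
    (hf : ∀ i, PolyGrowth (f i)) : PolyGrowth (fun x => ∑ i ∈ s, f i x) := by
  classical
  induction s using Finset.induction_on with
  | empty => simpa using const (0 : ℝ)
  | insert a s ha ih => simpa only [Finset.sum_insert ha] using (hf a).add ih

lemma clm_apply [NormedSpace ℝ V] [NormedSpace ℝ W] [NormedSpace ℝ U] {f : V → W →L[ℝ] U}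
    {g : V → W} (hf : PolyGrowth f) (hg : PolyGrowth g) : PolyGrowth (fun x => f x (g x)) :=
  bilin (ContinuousLinearMap.id ℝ (W →L[ℝ] U)) hf hg

lemma comp {f : W → U} {g : V → W} (hf : PolyGrowth f) (hg : PolyGrowth g) :
    PolyGrowth (fun x => f (g x)) := by
  obtain ⟨hfc, C, m, hC, hf⟩ := hf
  obtain ⟨hgc, D, k, hD, hg⟩ := hg
  refine of_bound (by fun_prop) (C := C * (1 + D) ^ m) (m := k * m) fun x => ?_
  have h1 : 1 ≤ (1 + ‖x‖) ^ k := one_le_pow₀ (by simp)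
  calc ‖f (g x)‖ ≤ C * (1 + ‖g x‖) ^ m := hf _
    _ ≤ C * ((1 + D) * (1 + ‖x‖) ^ k) ^ m := by
      gcongr
      linarith [hg x]
    _ = _ := by rw [mul_pow, ← pow_mul]; ring

lemma integrable [NormedSpace ℝ V] [MeasurableSpace V] [BorelSpace V] [SecondCountableTopology V]
    [CompleteSpace V] {μ : Measure V} [IsGaussian μ] {f : V → ℝ} (hf : PolyGrowth f) :
    Integrable f μ := by
  obtain ⟨hfc, C, m, hC, hf⟩ := hf
  have hid : MemLp (fun x : V => ‖x‖) m μ := (IsGaussian.memLp_id μ m (by simp)).norm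
  have hone : MemLp (fun _ : V => (1 : ℝ)) m μ := memLp_const 1
  have h : Integrable (fun x : V => ‖1 + ‖x‖‖ ^ m) μ := (hone.add hid).integrable_norm_pow'
  refine (h.const_mul C).mono' hfc.aestronglyMeasurable (.of_forall fun x => ?_)
  rw [Real.norm_of_nonneg (show 0 ≤ 1 + ‖x‖ by positivity)]
  exact hf x

end PolyGrowth

section Gaussian

variable {n : ℕ}

local notation "E" => EuclideanSpace ℝ (Fin n)

lemma integral_gaussianMeasure (n : ℕ) {W : Type*} [NormedAddCommGroup W] [NormedSpace ℝ W]
    (f : EuclideanSpace ℝ (Fin n) → W) : ∫ x, f x ∂gaussianMeasure n =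
      ∫ x, ((2 * π) ^ (-(n : ℝ) / 2) * Real.exp (-‖x‖ ^ 2 / 2)) • f x := by
  rw [gaussianMeasure, integral_withDensity_eq_integral_toReal_smul (by fun_prop) (by simp)]
  congr with x
  rw [ENNReal.toReal_ofReal (by positivity)]

lemma integrable_gaussianMeasure_iff (f : E → ℝ) : Integrable f (gaussianMeasure n) ↔
    Integrable (fun x => ((2 * π) ^ (-(n : ℝ) / 2) * Real.exp (-‖x‖ ^ 2 / 2)) * f x) := by
  rw [gaussianMeasure, integrable_withDensity_iff_integrable_smul' (by fun_prop) (by simp)]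
  congr! with x
  rw [ENNReal.toReal_ofReal (by positivity)]

lemma charFun_gaussianMeasure (t : E) :
    charFun (gaussianMeasure n) t = Complex.exp (-‖t‖ ^ 2 / 2) := by
  have h := GaussianFourier.integral_cexp_neg_mul_sq_norm_add_of_euclideanSpace (b := 1 / 2)
    (by simp) Complex.I t
  have hc : (((2 * π) ^ (-(n : ℝ) / 2) : ℝ) : ℂ) * (π / (1 / 2) : ℂ) ^ ((n : ℂ) / 2) = 1 := by
    rw [show (π / (1 / 2) : ℂ) = ((2 * π : ℝ) : ℂ) by push_cast; ring,
      show ((n : ℂ) / 2) = ((n / 2 : ℝ) : ℂ) by push_cast; ring,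
      ← Complex.ofReal_cpow (by positivity), ← Complex.ofReal_mul,
      ← Real.rpow_add (by positivity)]
    simp [neg_div]
  rw [charFun_apply, integral_gaussianMeasure]
  calc _ = ∫ v : E, (((2 * π) ^ (-(n : ℝ) / 2) : ℝ) : ℂ) *
        Complex.exp (-(1 / 2) * ‖v‖ ^ 2 + Complex.I * ⟪t, v⟫) := by
        congr with v
        rw [Complex.exp_add, Complex.real_smul, real_inner_comm t v]
        push_cast
        ring_nf
    _ = Complex.exp (-‖t‖ ^ 2 / 2) := by
        rw [integral_const_mul, h, ← mul_assoc, Fintype.card_fin, hc, one_mul, Complex.I_sq]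
        ring_nf

lemma gaussianMeasure_eq_stdGaussian : gaussianMeasure n = stdGaussian E := by
  have : IsFiniteMeasure (gaussianMeasure n) := by
    have h := charFun_gaussianMeasure (0 : E)
    rw [charFun_zero] at h
    refine ⟨lt_top_iff_ne_top.2 fun htop => ?_⟩
    simp [Measure.real, htop] at h
  refine Measure.ext_of_charFun (funext fun t => ?_)
  rw [charFun_gaussianMeasure, charFun_stdGaussian]

instance isGaussian_gaussianMeasure (n : ℕ) : IsGaussian (gaussianMeasure n) := by
  rw [gaussianMeasure_eq_stdGaussian]
  infer_instance

lemma map_rotation_gaussianMeasure_prod (θ : ℝ) :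
    ((gaussianMeasure n).prod (gaussianMeasure n)).map (ContinuousLinearMap.rotation θ) =
      (gaussianMeasure n).prod (gaussianMeasure n) := by
  refine IsGaussian.map_rotation_eq_self_of_forall_strongDual_eq_zero (fun L => ?_) θ
  rw [gaussianMeasure_eq_stdGaussian]
  exact integral_strongDual_stdGaussian L

lemma integral_comp_rotation (θ : ℝ) {G : E × E → ℝ} (hG : Continuous G) :
    ∫ z, G (ContinuousLinearMap.rotation θ z) ∂(gaussianMeasure n).prod (gaussianMeasure n) =
      ∫ z, G z ∂(gaussianMeasure n).prod (gaussianMeasure n) := by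
  conv_rhs => rw [← map_rotation_gaussianMeasure_prod θ]
  rw [integral_map (by fun_prop) hG.aestronglyMeasurable]

lemma polyGrowth_inner_left (v : E) : PolyGrowth (fun x : E => ⟪v, x⟫) :=
  .clm (innerSL ℝ v)

/-- Gaussian integration by parts in the direction `v`. -/
lemma integral_inner_mul_gaussianMeasure {F : E → ℝ} (hd : Differentiable ℝ F)
    (hF : PolyGrowth F) (hF' : PolyGrowth (fderiv ℝ F)) (v : E) :
    ∫ x, ⟪v, x⟫ * F x ∂gaussianMeasure n = ∫ x, fderiv ℝ F x v ∂gaussianMeasure n := by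
  set c : ℝ := (2 * π) ^ (-(n : ℝ) / 2)
  let ρ : E → ℝ := fun x => c * Real.exp (-‖x‖ ^ 2 / 2)
  have hρ (x : E) : HasFDerivAt ρ (-(ρ x) • innerSL ℝ x) x := by
    have h := (((hasStrictFDerivAt_norm_sq x).hasFDerivAt.neg.mul_const (1 / 2 : ℝ)).exp).const_mul c
    refine (h.congr_fderiv ?_).congr_of_eventuallyEq (.of_forall fun y => ?_)
    · ext y
      simp [ρ]
      ring_nf
    · simp only [ρ, Pi.neg_apply]
      ring_nf
  have key := integral_mul_fderiv_eq_neg_fderiv_mul_of_integrable (μ := volume) (f := ρ) (g := F)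
    (v := v) ?_ ?_ ?_ (fun x _ => (hρ x).differentiableAt) (fun x _ => hd x)
  · rw [integral_gaussianMeasure, integral_gaussianMeasure]
    simp only [smul_eq_mul]
    refine Eq.trans ?_ key.symm
    rw [← integral_neg]
    congr with x
    rw [(hρ x).fderiv]
    simp [ρ, c, real_inner_comm v x]
    ring
  · have := ((integrable_gaussianMeasure_iff _).1 ((polyGrowth_inner_left v).mul hF).integrable).neg
    refine this.congr (.of_forall fun x => ?_)
    beta_reduce
    rw [(hρ x).fderiv]
    simp [ρ, c, real_inner_comm v x]
    ring
  · exact (integrable_gaussianMeasure_iff _).1 (hF'.clm_apply (.const v)).integrable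
  · exact (integrable_gaussianMeasure_iff _).1 hF.integrable

lemma fst_rotation_neg_rotation (θ : ℝ) (z : E × E) :
    (ContinuousLinearMap.rotation (-θ) (ContinuousLinearMap.rotation θ z)).1 = z.1 := by
  simp only [ContinuousLinearMap.rotation_apply, Real.cos_neg, Real.sin_neg]
  ext i
  simp
  linear_combination (z.1 i) * Real.cos_sq_add_sin_sq θ

lemma norm_rotation_le (θ : ℝ) (z : E × E) : ‖ContinuousLinearMap.rotation θ z‖ ≤ 2 * ‖z‖ := by
  have hc : |Real.cos θ| ≤ 1 := Real.abs_cos_le_one θ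
  have hs : |Real.sin θ| ≤ 1 := Real.abs_sin_le_one θ
  have h (a b : ℝ) (ha : |a| ≤ 1) (hb : |b| ≤ 1) : ‖a • z.1 + b • z.2‖ ≤ 2 * ‖z‖ := by
    calc ‖a • z.1 + b • z.2‖ ≤ |a| * ‖z.1‖ + |b| * ‖z.2‖ := by
          simpa [norm_smul] using norm_add_le (a • z.1) (b • z.2)
      _ ≤ 1 * ‖z‖ + 1 * ‖z‖ := by
          gcongr
          exacts [norm_fst_le z, norm_snd_le z]
      _ = 2 * ‖z‖ := by ring
  rw [ContinuousLinearMap.rotation_apply]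
  exact max_le (h _ _ hc hs) (h _ _ (by rwa [abs_neg]) hc)

lemma hasDerivAt_fst_rotation (z : E × E) (θ : ℝ) :
    HasDerivAt (fun θ => (ContinuousLinearMap.rotation θ z).1)
      (ContinuousLinearMap.rotation θ z).2 θ := by
  simp only [ContinuousLinearMap.rotation_apply]
  exact ((Real.hasDerivAt_cos θ).smul_const z.1).add ((Real.hasDerivAt_sin θ).smul_const z.2)

lemma PolyGrowth.comp_fst {W : Type*} [NormedAddCommGroup W] {f : E → W} (hf : PolyGrowth f) :
    PolyGrowth (fun z : E × E => f z.1) :=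
  hf.comp (.clm (ContinuousLinearMap.fst ℝ E E))

lemma PolyGrowth.comp_fst_rotation {W : Type*} [NormedAddCommGroup W] {f : E → W}
    (hf : PolyGrowth f) (θ : ℝ) :
    PolyGrowth (fun z : E × E => f (ContinuousLinearMap.rotation θ z).1) :=
  hf.comp (.clm ((ContinuousLinearMap.fst ℝ E E).comp (ContinuousLinearMap.rotation θ)))

/-- The Gaussian correlation `θ ↦ 𝔼[f(X) f(cos θ X + sin θ Y)]`. -/
noncomputable def gaussianCorrelation (f : E → ℝ) (θ : ℝ) : ℝ :=
  ∫ z, f z.1 * f (ContinuousLinearMap.rotation θ z).1 ∂(gaussianMeasure n).prod (gaussianMeasure n)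

lemma hasDerivAt_gaussianCorrelation_integral_fderiv {f : E → ℝ} (hd : Differentiable ℝ f)
    (hf : PolyGrowth f) (hf' : PolyGrowth (fderiv ℝ f)) (θ : ℝ) :
    HasDerivAt (gaussianCorrelation f)
      (∫ z, f z.1 * fderiv ℝ f (ContinuousLinearMap.rotation θ z).1
        (ContinuousLinearMap.rotation θ z).2 ∂(gaussianMeasure n).prod (gaussianMeasure n)) θ := by
  obtain ⟨C, m, hC, hb⟩ := hf.2
  obtain ⟨D, k, hD, hb'⟩ := hf'.2
  let bound : E × E → ℝ := fun z =>
    (C * (1 + ‖z‖) ^ m) * (D * (1 + 2 * ‖z‖) ^ k * (2 * ‖z‖))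
  have hbound : PolyGrowth bound := by
    refine .of_bound (by fun_prop) (C := C * (D * 2 ^ k * 2)) (m := m + k + 1) fun z => ?_
    rw [Real.norm_of_nonneg (by positivity)]
    calc bound z ≤ (C * (1 + ‖z‖) ^ m) * (D * (2 * (1 + ‖z‖)) ^ k * (2 * (1 + ‖z‖))) := by
          dsimp only [bound]
          gcongr <;> linarith [norm_nonneg z]
      _ = _ := by rw [mul_pow]; ring
  have hcont : Continuous (fderiv ℝ f) := hf'.1
  refine (hasDerivAt_integral_of_dominated_loc_of_deriv_le (s := Set.univ) (bound := bound)
    (F' := fun θ z => f z.1 * fderiv ℝ f (ContinuousLinearMap.rotation θ z).1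
        (ContinuousLinearMap.rotation θ z).2) Filter.univ_mem ?_ ?_ ?_ ?_ hbound.integrable ?_).2
  · exact .of_forall fun θ => (hf.comp_fst.mul (hf.comp_fst_rotation θ)).1.aestronglyMeasurable
  · exact (hf.comp_fst.mul (hf.comp_fst_rotation θ)).integrable
  · exact (hf.comp_fst.1.mul ((hf'.comp_fst_rotation θ).1.clm_apply
      (by fun_prop))).aestronglyMeasurable
  · refine .of_forall fun z θ _ => ?_
    have h1 : ‖(ContinuousLinearMap.rotation θ z).1‖ ≤ 2 * ‖z‖ :=
      (norm_fst_le _).trans (norm_rotation_le θ z)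
    have h2 : ‖(ContinuousLinearMap.rotation θ z).2‖ ≤ 2 * ‖z‖ :=
      (norm_snd_le _).trans (norm_rotation_le θ z)
    rw [norm_mul]
    refine mul_le_mul ((hb _).trans ?_) ((ContinuousLinearMap.le_opNorm _ _).trans
      (mul_le_mul ((hb' _).trans ?_) h2 (norm_nonneg _) (by positivity)))
      (norm_nonneg _) (by positivity)
    · gcongr
      exact norm_fst_le z
    · gcongr
  · refine .of_forall fun z θ _ => ?_
    exact ((hd _).hasFDerivAt.comp_hasDerivAt θ (hasDerivAt_fst_rotation z θ)).const_mul (f z.1)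

lemma clm_apply_eq_sum (L : E →L[ℝ] ℝ) (v : E) :
    L v = ∑ i, v i * L (EuclideanSpace.single i 1) := by
  conv_lhs => rw [← (EuclideanSpace.basisFun (Fin n) ℝ).sum_repr v]
  simp

lemma hasDerivAt_gaussianCorrelation {f : E → ℝ} (hd : Differentiable ℝ f)
    (hf : PolyGrowth f) (hf' : PolyGrowth (fderiv ℝ f)) (θ : ℝ) :
    HasDerivAt (gaussianCorrelation f)
      (-Real.sin θ * ∑ i, gaussianCorrelation (partialDeriv i f) (-θ)) θ := by
  refine (hasDerivAt_gaussianCorrelation_integral_fderiv hd hf hf' θ).congr_deriv ?_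
  have hp (i : Fin n) : PolyGrowth (partialDeriv i f) := hf'.clm_apply (.const _)
  have hsnd (i : Fin n) : PolyGrowth (fun w : E × E => w.2 i) :=
    .clm ((EuclideanSpace.proj i).comp (ContinuousLinearMap.snd ℝ E E))
  have hint (i : Fin n) : PolyGrowth (fun w : E × E =>
      f (ContinuousLinearMap.rotation (-θ) w).1 * (w.2 i * partialDeriv i f w.1)) :=
    (hf.comp_fst_rotation (-θ)).mul ((hsnd i).mul (hp i).comp_fst)
  have hcont : Continuous (fderiv ℝ f) := hf'.1
  have hfc : Continuous f := hf.1
  calc _ = ∫ w, f (ContinuousLinearMap.rotation (-θ) w).1 * fderiv ℝ f w.1 w.2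
        ∂(gaussianMeasure n).prod (gaussianMeasure n) := by
        rw [← integral_comp_rotation θ (G := fun w : E × E =>
          f (ContinuousLinearMap.rotation (-θ) w).1 * fderiv ℝ f w.1 w.2) (by fun_prop)]
        simp_rw [fst_rotation_neg_rotation]
    _ = ∑ i, ∫ w, f (ContinuousLinearMap.rotation (-θ) w).1 * (w.2 i * partialDeriv i f w.1)
        ∂(gaussianMeasure n).prod (gaussianMeasure n) := by
        rw [← integral_finsetSum _ fun i _ => (hint i).integrable]
        simp_rw [← Finset.mul_sum, partialDeriv, ← clm_apply_eq_sum]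
    _ = ∑ i, -Real.sin θ * gaussianCorrelation (partialDeriv i f) (-θ) := by
        refine Finset.sum_congr rfl fun i _ => ?_
        rw [gaussianCorrelation, integral_prod _ (hint i).integrable,
          integral_prod _ ((hp i).comp_fst.mul ((hp i).comp_fst_rotation (-θ))).integrable,
          ← integral_const_mul]
        refine integral_congr_ae (.of_forall fun u => ?_)
        let A : E → E := fun v => (ContinuousLinearMap.rotation (-θ) (u, v)).1
        have hA : A = fun v => Real.cos θ • u + (-Real.sin θ) • v := by
          ext v
          simp [A, ContinuousLinearMap.rotation_apply]
        have hAd (v : E) : HasFDerivAt A ((-Real.sin θ) • ContinuousLinearMap.id ℝ E) v := by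
          rw [hA]
          exact ((hasFDerivAt_id v).const_smul (-Real.sin θ)).const_add _
        have hAg : PolyGrowth A := by
          rw [hA]
          exact (PolyGrowth.const _).add
            (.clm ((-Real.sin θ) • ContinuousLinearMap.id ℝ E))
        have hder (v : E) : fderiv ℝ (fun v => f (A v)) v =
            (-Real.sin θ) • fderiv ℝ f (A v) := by
          refine (((hd (A v)).hasFDerivAt.comp v (hAd v)).congr_fderiv ?_).fderiv
          ext w
          simp
        have hder' : PolyGrowth (fderiv ℝ fun v => f (A v)) := by
          rw [funext hder]
          exact PolyGrowth.bilin (ContinuousLinearMap.lsmul ℝ ℝ) (.const _) (hf'.comp hAg)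
        have key := integral_inner_mul_gaussianMeasure (F := fun v => f (A v))
          (fun v => ((hd (A v)).comp v (hAd v).differentiableAt)) (hf.comp hAg) hder'
          (EuclideanSpace.single i 1)
        calc _ = partialDeriv i f u *
              ∫ v, ⟪EuclideanSpace.single i 1, v⟫ * f (A v) ∂gaussianMeasure n := by
              rw [← integral_const_mul]
              refine integral_congr_ae (.of_forall fun v => ?_)
              simp [A, EuclideanSpace.inner_single_left]
              ring
          _ = _ := by
              beta_reduce
              rw [key, ← integral_const_mul, ← integral_const_mul]
              refine integral_congr_ae (.of_forall fun v => ?_)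
              simp [hder, partialDeriv, A]
              ring
    _ = _ := by rw [Finset.mul_sum]

lemma integral_fst_gaussianMeasure_prod (f : E → ℝ) :
    ∫ z, f z.1 ∂(gaussianMeasure n).prod (gaussianMeasure n) = ∫ x, f x ∂gaussianMeasure n := by
  simpa using integral_prod_mul (μ := gaussianMeasure n) (ν := gaussianMeasure n) f (fun _ => 1)

lemma gaussianCorrelation_zero (f : E → ℝ) :
    gaussianCorrelation f 0 = ∫ x, f x ^ 2 ∂gaussianMeasure n := by
  rw [← integral_fst_gaussianMeasure_prod fun x => f x ^ 2]
  simp [gaussianCorrelation, ContinuousLinearMap.rotation_apply, pow_two]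

lemma gaussianCorrelation_pi_div_two (f : E → ℝ) :
    gaussianCorrelation f (π / 2) = (∫ x, f x ∂gaussianMeasure n) ^ 2 := by
  simp [gaussianCorrelation, ContinuousLinearMap.rotation_apply, integral_prod_mul, pow_two]

lemma gaussianCorrelation_le {f : E → ℝ} (hf : PolyGrowth f) (θ : ℝ) :
    gaussianCorrelation f θ ≤ ∫ x, f x ^ 2 ∂gaussianMeasure n := by
  have h1 := hf.comp_fst.sq.integrable (μ := (gaussianMeasure n).prod (gaussianMeasure n))
  have h2 := (hf.comp_fst_rotation θ).sq.integrable
    (μ := (gaussianMeasure n).prod (gaussianMeasure n))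
  calc gaussianCorrelation f θ
      ≤ ∫ z, (1 / 2 * f z.1 ^ 2 + 1 / 2 * f (ContinuousLinearMap.rotation θ z).1 ^ 2)
        ∂(gaussianMeasure n).prod (gaussianMeasure n) := by
        refine integral_mono (hf.comp_fst.mul (hf.comp_fst_rotation θ)).integrable
          ((h1.const_mul _).add (h2.const_mul _)) fun z => ?_
        nlinarith [sq_nonneg (f z.1 - f (ContinuousLinearMap.rotation θ z).1)]
    _ = ∫ x, f x ^ 2 ∂gaussianMeasure n := by
        rw [integral_add (h1.const_mul _) (h2.const_mul _), integral_const_mul, integral_const_mul,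
          integral_comp_rotation θ (G := fun z => f z.1 ^ 2) hf.comp_fst.sq.1,
          integral_fst_gaussianMeasure_prod fun x => f x ^ 2]
        ring

/-- The Gaussian Poincaré inequality. -/
lemma gaussian_poincare {f : E → ℝ} (hd : Differentiable ℝ f)
    (hf : PolyGrowth f) (hf' : PolyGrowth (fderiv ℝ f)) :
    ∫ x, f x ^ 2 ∂gaussianMeasure n - (∫ x, f x ∂gaussianMeasure n) ^ 2 ≤
      ∑ i, ∫ x, partialDeriv i f x ^ 2 ∂gaussianMeasure n := by
  set D := ∑ i, ∫ x, partialDeriv i f x ^ 2 ∂gaussianMeasure n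
  have hder (θ : ℝ) := (hasDerivAt_gaussianCorrelation hd hf hf' θ).sub
    ((Real.hasDerivAt_cos θ).mul_const D)
  have hmono : MonotoneOn (fun θ => gaussianCorrelation f θ - Real.cos θ * D)
      (Set.Icc 0 (π / 2)) := by
    refine monotoneOn_of_deriv_nonneg (convex_Icc _ _)
      (fun θ _ => (hder θ).continuousAt.continuousWithinAt)
      (fun θ _ => (hder θ).differentiableAt.differentiableWithinAt) fun θ hθ => ?_
    rw [interior_Icc] at hθ
    refine (hder θ).deriv.symm ▸ ?_
    have hs : 0 ≤ Real.sin θ :=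
      Real.sin_nonneg_of_nonneg_of_le_pi hθ.1.le (by linarith [hθ.2, Real.pi_pos])
    have hle : ∑ i, gaussianCorrelation (partialDeriv i f) (-θ) ≤ D :=
      Finset.sum_le_sum fun i _ => gaussianCorrelation_le (hf'.clm_apply (.const _)) _
    nlinarith
  have h := hmono (a := 0) (b := π / 2) ⟨le_rfl, by positivity⟩ ⟨by positivity, le_rfl⟩
    (by positivity)
  simp only [gaussianCorrelation_zero, gaussianCorrelation_pi_div_two, Real.cos_zero,
    Real.cos_pi_div_two] at h
  linarith

lemma hasFDerivAt_partialDeriv {f : E → ℝ} (hf : ContDiff ℝ 2 f) (i : Fin n) (x : E) :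
    HasFDerivAt (partialDeriv i f)
      ((fderiv ℝ (fderiv ℝ f) x).flip (EuclideanSpace.single i 1)) x := by
  have hfd : Differentiable ℝ (fderiv ℝ f) :=
    (hf.fderiv_right (m := 1) (by norm_num)).differentiable (by norm_num)
  exact ((hfd x).hasFDerivAt.clm_apply (hasFDerivAt_const _ x)).congr_fderiv (by ext; simp)

lemma polyGrowth_fderiv_partialDeriv {f : E → ℝ} (hf : ContDiff ℝ 2 f)
    (hf'' : PolyGrowth (fderiv ℝ (fderiv ℝ f))) (i : Fin n) :
    PolyGrowth (fderiv ℝ (partialDeriv i f)) := by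
  rw [funext fun x => (hasFDerivAt_partialDeriv hf i x).fderiv]
  exact PolyGrowth.bilin
    (ContinuousLinearMap.flipₗᵢ ℝ E E ℝ).toContinuousLinearEquiv.toContinuousLinearMap
    hf'' (.const _)

lemma ouOperator_eq_sum (f : E → ℝ) (x : E) : ouOperator f x =
    ∑ i, (⟪EuclideanSpace.single i 1, x⟫ * partialDeriv i f x -
      partialDeriv i (partialDeriv i f) x) := by
  have : ⟪x, gradient f x⟫ = ∑ i, x i * partialDeriv i f x := by
    rw [real_inner_comm, gradient, InnerProductSpace.toDual_symm_apply, clm_apply_eq_sum]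
    rfl
  simp [ouOperator, this, laplacian, EuclideanSpace.inner_single_left]

lemma polyGrowth_ouOperator {f : E → ℝ} (hf : ContDiff ℝ 2 f) (hf' : PolyGrowth (fderiv ℝ f))
    (hf'' : PolyGrowth (fderiv ℝ (fderiv ℝ f))) : PolyGrowth (ouOperator f) := by
  rw [funext (ouOperator_eq_sum f)]
  exact .sum _ fun i => ((polyGrowth_inner_left _).mul (hf'.clm_apply (.const _))).sub
    ((polyGrowth_fderiv_partialDeriv hf hf'' i).clm_apply (.const _))

/-- The Dirichlet form of the Ornstein–Uhlenbeck operator. -/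
lemma integral_mul_ouOperator {f g : E → ℝ} (hf : ContDiff ℝ 2 f) (hf' : PolyGrowth (fderiv ℝ f))
    (hf'' : PolyGrowth (fderiv ℝ (fderiv ℝ f))) (hgd : Differentiable ℝ g) (hg : PolyGrowth g)
    (hg' : PolyGrowth (fderiv ℝ g)) :
    ∫ x, g x * ouOperator f x ∂gaussianMeasure n =
      ∑ i, ∫ x, partialDeriv i g x * partialDeriv i f x ∂gaussianMeasure n := by
  have hp (i : Fin n) : PolyGrowth (partialDeriv i f) := hf'.clm_apply (.const _)
  have hq (i : Fin n) : PolyGrowth (partialDeriv i g) := hg'.clm_apply (.const _)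
  have hp' (i : Fin n) := polyGrowth_fderiv_partialDeriv hf hf'' i
  have hpp (i : Fin n) : PolyGrowth (partialDeriv i (partialDeriv i f)) :=
    (hp' i).clm_apply (.const _)
  have hx (i : Fin n) := polyGrowth_inner_left (EuclideanSpace.single i (1 : ℝ))
  have hprod (i : Fin n) (x : E) : HasFDerivAt (fun x => g x * partialDeriv i f x)
      (g x • fderiv ℝ (partialDeriv i f) x + partialDeriv i f x • fderiv ℝ g x) x :=
    (hgd x).hasFDerivAt.mul (hasFDerivAt_partialDeriv hf i x).differentiableAt.hasFDerivAt
  have hparts (i : Fin n) := integral_inner_mul_gaussianMeasure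
    (F := fun x => g x * partialDeriv i f x) (fun x => (hprod i x).differentiableAt)
    (hg.mul (hp i)) (by
      rw [funext fun x => (hprod i x).fderiv]
      exact (hg.bilin (ContinuousLinearMap.lsmul ℝ ℝ) (hp' i)).add
        ((hp i).bilin (ContinuousLinearMap.lsmul ℝ ℝ) hg'))
    (EuclideanSpace.single i 1)
  have hou (x : E) : g x * ouOperator f x = ∑ i,
      (⟪EuclideanSpace.single i 1, x⟫ * (g x * partialDeriv i f x) -
        g x * partialDeriv i (partialDeriv i f) x) := by
    rw [ouOperator_eq_sum, Finset.mul_sum]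
    exact Finset.sum_congr rfl fun i _ => by ring
  simp_rw [hou]
  rw [integral_finsetSum _ fun i _ => (((hx i).mul (hg.mul (hp i))).sub (hg.mul (hpp i))).integrable]
  refine Finset.sum_congr rfl fun i _ => ?_
  rw [integral_sub ((hx i).mul (hg.mul (hp i))).integrable (hg.mul (hpp i)).integrable, hparts i,
    sub_eq_iff_eq_add, ← integral_add ((hq i).mul (hp i)).integrable (hg.mul (hpp i)).integrable]
  refine integral_congr_ae (.of_forall fun x => ?_)
  simp only [(hprod i x).fderiv]
  simp [partialDeriv]
  ring

end Gaussian

/-- Bound on the χ²-divergence of `P = p·γ` from `γ` in terms of the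
Ornstein–Uhlenbeck operator applied to the density `p`. -/
theorem chiSq_divergence_le (n : ℕ) (p : EuclideanSpace ℝ (Fin n) → ℝ)
    (hp : CPoly 2 n p) (hp0 : ∀ x, 0 ≤ p x)
    (hp1 : ∫ x, p x ∂gaussianMeasure n = 1) :
    ∫ x, (p x - 1) ^ 2 ∂gaussianMeasure n ≤
      ∫ x, (ouOperator p x) ^ 2 ∂gaussianMeasure n := by
  obtain ⟨hC, hb⟩ := hp
  have hC2 : ContDiff ℝ 2 p := hC
  have hC1 : ContDiff ℝ 1 (fderiv ℝ p) := hC2.fderiv_right (by norm_num)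
  have hpg : PolyGrowth p := by
    obtain ⟨C, m, h⟩ := hb 0 (by norm_num)
    exact .of_bound hC2.continuous fun x => by simpa using h x
  have hpg' : PolyGrowth (fderiv ℝ p) := by
    obtain ⟨C, m, h⟩ := hb 1 (by norm_num)
    exact .of_bound hC1.continuous fun x => by
      simpa [← norm_iteratedFDeriv_fderiv] using h x
  have hpg'' : PolyGrowth (fderiv ℝ (fderiv ℝ p)) := by
    obtain ⟨C, m, h⟩ := hb 2 (by norm_num)
    exact .of_bound (hC1.continuous_fderiv (by norm_num)) fun x => by
      simpa [← norm_iteratedFDeriv_fderiv] using h x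
  have hq : PolyGrowth (fun x => p x - 1) := hpg.sub (.const 1)
  have hqd : Differentiable ℝ (fun x => p x - 1) :=
    (hC2.differentiable (by norm_num)).sub_const 1
  have hfq : fderiv ℝ (fun x => p x - 1) = fderiv ℝ p := by
    ext1 x
    exact fderiv_sub_const 1
  have hpart (i : Fin n) : partialDeriv i (fun x => p x - 1) = partialDeriv i p := by
    ext x
    rw [partialDeriv, partialDeriv, hfq]
  have hmean : ∫ x, (p x - 1) ∂gaussianMeasure n = 0 := by
    rw [integral_sub hpg.integrable (integrable_const 1), hp1]
    simp
  have hou : PolyGrowth (ouOperator p) := polyGrowth_ouOperator hC2 hpg' hpg''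
  have hpoin := gaussian_poincare hqd hq (hfq ▸ hpg')
  have hdir := integral_mul_ouOperator hC2 hpg' hpg'' hqd hq (hfq ▸ hpg')
  simp only [hpart, hmean] at hpoin hdir
  simp only [← pow_two] at hdir
  rw [← hdir] at hpoin
  have hamgm : ∫ x, (p x - 1) * ouOperator p x ∂gaussianMeasure n ≤
      ∫ x, (1 / 2 * (p x - 1) ^ 2 + 1 / 2 * ouOperator p x ^ 2) ∂gaussianMeasure n := by
    refine integral_mono (hq.mul hou).integrable
      ((hq.sq.integrable.const_mul _).add (hou.sq.integrable.const_mul _)) fun x => ?_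
    nlinarith [sq_nonneg (p x - 1 - ouOperator p x)]
  rw [integral_add (hq.sq.integrable.const_mul _) (hou.sq.integrable.const_mul _),
    integral_const_mul, integral_const_mul] at hamgm
  linarith
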